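/- Let N ≥ 2, let H be a Finsler norm on ℝ^N, and let B satisfy assumption (h_B) with p ≥ 2, κ = 0, and parameters γ > 0, Γ > 0. Let q > 1 and let u be a stable weak solution of −div(B'(H(∇u))∇H(∇u)) = |u|^{q−1}u in ℝ^N. Suppose q > Γγ^{−1}(p−1) and N < s(q) := p[Γγ^{−1}(p−1)(q−1) + 2q + 2√(q(q − Γγ^{−1}(p−1)))] / [Γγ^{−1}(p−1)(q−(p−1))]. Then u ≡ 0. -/

import Mathlib

open MeasureTheory Real Set
open scoped RealInnerProductSpace

noncomputable section

/-- A Finsler norm on `ℝ^N`: a norm of class `C²` away from the origin whose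
open unit ball is uniformly convex. -/
def IsFinslerNorm {N : ℕ} (H : EuclideanSpace ℝ (Fin N) → ℝ) : Prop :=
  (∀ x, H x = 0 ↔ x = 0) ∧
  (∀ (c : ℝ) (x : EuclideanSpace ℝ (Fin N)), H (c • x) = |c| * H x) ∧
  (∀ x y, H (x + y) ≤ H x + H y) ∧
  ContDiffOn ℝ 2 H {(0 : EuclideanSpace ℝ (Fin N))}ᶜ ∧
  ∃ Λ : ℝ, 0 < Λ ∧ ∀ ξ : EuclideanSpace ℝ (Fin N), H ξ = 1 →
    ∀ v : EuclideanSpace ℝ (Fin N), ⟪gradient H ξ, v⟫ = 0 →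
      Λ * ‖v‖ ^ 2 ≤ ⟪fderiv ℝ (gradient H) ξ v, v⟫

/-- Assumption `(h_B)` with parameters `p, κ, γ, Γ`. -/
def SatisfiesHB (B : ℝ → ℝ) (p κ γ Γ : ℝ) : Prop :=
  ContDiffOn ℝ 2 B (Set.Ioi 0) ∧ B 0 = 0 ∧ deriv B 0 = 0 ∧
  (∀ t : ℝ, 0 < t → 0 < B t ∧ 0 < deriv B t ∧ 0 < deriv (deriv B) t) ∧
  1 < p ∧ 0 ≤ κ ∧ κ ≤ 1 ∧ 0 < γ ∧ 0 < Γ ∧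
  (∀ t : ℝ, 0 < t →
    γ * (κ + t) ^ (p - 2) * t ≤ deriv B t ∧ deriv B t ≤ Γ * (κ + t) ^ (p - 2) * t) ∧
  (∀ t : ℝ, 0 < t →
    γ * (p - 1) * (κ + t) ^ (p - 2) ≤ deriv (deriv B) t ∧
      deriv (deriv B) t ≤ Γ * (p - 1) * (κ + t) ^ (p - 2))

/-- `u` is a weak solution of `-div(B'(H(∇u)) ∇H(∇u)) = |u|^{q-1} u` in `Ω`. -/
def IsWeakSolutionOn {N : ℕ} (Ω : Set (EuclideanSpace ℝ (Fin N))) (B : ℝ → ℝ)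
    (H : EuclideanSpace ℝ (Fin N) → ℝ) (u : EuclideanSpace ℝ (Fin N) → ℝ) (q : ℝ) : Prop :=
  ∀ φ : EuclideanSpace ℝ (Fin N) → ℝ, ContDiff ℝ 1 φ → HasCompactSupport φ → tsupport φ ⊆ Ω →
    ∫ x in Ω, deriv B (H (gradient u x)) * ⟪gradient H (gradient u x), gradient φ x⟫
      = ∫ x in Ω, |u x| ^ (q - 1) * u x * φ x

/-- Stability of the linearized operator of `u`, tested against `C¹` functions compactly
supported in `S ⊆ Ω` (take `S = Ω` for stability, `S = Ω \ K` for stability outside a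
compact set `K`). -/
def IsStableOn {N : ℕ} (Ω S : Set (EuclideanSpace ℝ (Fin N))) (B : ℝ → ℝ)
    (H : EuclideanSpace ℝ (Fin N) → ℝ) (u : EuclideanSpace ℝ (Fin N) → ℝ) (q : ℝ) : Prop :=
  ∀ φ : EuclideanSpace ℝ (Fin N) → ℝ, ContDiff ℝ 1 φ → HasCompactSupport φ → tsupport φ ⊆ S →
    0 ≤ (∫ x in Ω, deriv (deriv B) (H (gradient u x)) *
            ⟪gradient H (gradient u x), gradient φ x⟫ ^ 2)
        + (∫ x in Ω, deriv B (H (gradient u x)) *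
            ⟪fderiv ℝ (gradient H) (gradient u x) (gradient φ x), gradient φ x⟫)
        - ∫ x in Ω, q * |u x| ^ (q - 1) * φ x ^ 2

/-- The signed power `t ↦ |t|^r t` has derivative `(r + 1)|t|^r`. -/
lemma hasDerivAt_abs_rpow_mul_self {r : ℝ} (hr : 0 < r) (t : ℝ) :
    HasDerivAt (fun t : ℝ => |t| ^ r * t) ((r + 1) * |t| ^ r) t := by
  rcases eq_or_ne t 0 with rfl | ht
  · rw [hasDerivAt_iff_tendsto_slope_zero]
    have hc : Filter.Tendsto (fun t : ℝ => |t| ^ r) (nhdsWithin 0 {0}ᶜ) (nhds 0) := by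
      have : Continuous fun t : ℝ => |t| ^ r := continuous_abs.rpow_const fun _ => Or.inr hr.le
      have h := (this.tendsto 0).mono_left (nhdsWithin_le_nhds (s := {0}ᶜ))
      simpa [Real.zero_rpow hr.ne'] using h
    simp only [abs_zero, Real.zero_rpow hr.ne', mul_zero]
    refine hc.congr' ?_
    filter_upwards [self_mem_nhdsWithin] with s hs
    have hs' : s ≠ 0 := hs
    simp only [zero_add, smul_eq_mul, sub_zero]
    field_simp
  · have h := ((hasDerivAt_abs ht).rpow_const (p := r) (Or.inl (abs_ne_zero.2 ht))).mul
      (hasDerivAt_id t)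
    refine h.congr_deriv ?_
    have h1 : |t| ^ r = |t| ^ (r - 1) * |t| := by
      rw [Real.rpow_sub_one (abs_ne_zero.2 ht)]
      field_simp [abs_ne_zero.2 ht]
    have h2 : ((SignType.sign t : SignType) : ℝ) * t = |t| := sign_mul_self t
    simp only [id, h1, mul_one]
    linear_combination (r * |t| ^ (r - 1)) * h2

lemma contDiff_abs_rpow_mul_self {r : ℝ} (hr : 0 < r) :
    ContDiff ℝ 1 (fun t : ℝ => |t| ^ r * t) := by
  rw [contDiff_one_iff_deriv]
  refine ⟨fun t => (hasDerivAt_abs_rpow_mul_self hr t).differentiableAt, ?_⟩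
  have : deriv (fun t : ℝ => |t| ^ r * t) = fun t => (r + 1) * |t| ^ r :=
    funext fun t => (hasDerivAt_abs_rpow_mul_self hr t).deriv
  rw [this]
  exact continuous_const.mul (continuous_abs.rpow_const fun _ => Or.inr hr.le)

/-- A three-term weighted Young inequality for the mixed terms of the energy estimate. -/
lemma mixed_term_young {p q α ε : ℝ} (hp : 1 < p) (hα : 1 < α) (hq : p - 1 < q) (hε : 0 < ε)
    (j k : ℕ) (hj : 0 < j) (hjp : (j : ℝ) ≤ p) (hjk : j ≤ k)
    (hk : p * (q + α) / (q - (p - 1)) ≤ k) :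
    ∃ C : ℝ, 0 ≤ C ∧ ∀ h a s d : ℝ, 0 ≤ h → 0 ≤ a → 0 ≤ s → s ≤ 1 → 0 ≤ d →
      h ^ (p - j) * a ^ (α - 1 + j) * s ^ (k - j) * d ^ j ≤
        ε * (a ^ (α - 1) * h ^ p * s ^ k + a ^ (q + α) * s ^ k)
          + C * d ^ (p * (q + α) / (q - (p - 1))) := by
  set θ := p * (q + α) / (q - (p - 1)) with hθ
  have hq0 : 0 < q - (p - 1) := by linarith
  have hqα : 0 < q + α := by linarith
  have hp0 : 0 < p := by linarith
  have hθ0 : 0 < θ := by positivity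
  have hj0 : (0 : ℝ) < j := by exact_mod_cast hj
  have hjk' : (j : ℝ) ≤ k := by exact_mod_cast hjk
  set w₁ := (p - j) / p with hw₁
  set w₂ := j * (α + p - 1) / (p * (q + α)) with hw₂
  set w₃ := j / θ with hw₃
  have h1 : 0 ≤ w₁ := div_nonneg (by linarith) hp0.le
  have h2 : 0 ≤ w₂ := div_nonneg (mul_nonneg hj0.le (by linarith)) (by positivity)
  have h3 : 0 < w₃ := by positivity
  have hsum : w₁ + w₂ + w₃ = 1 := by
    rw [hw₁, hw₂, hw₃, hθ]; field_simp; ring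
  have hpα : w₁ * p = p - j := by rw [hw₁]; field_simp
  have hexp : (α - 1) * w₁ + (q + α) * w₂ = α - 1 + j := by
    rw [hw₁, hw₂]; field_simp; ring
  have hsk : k * w₁ + k * w₂ ≤ ((k - j : ℕ) : ℝ) := by
    rw [Nat.cast_sub hjk]
    have : k * w₁ + k * w₂ = k - k * w₃ := by linear_combination (k : ℝ) * hsum
    rw [this]
    have : (j : ℝ) ≤ k * w₃ := by
      rw [hw₃, mul_div_assoc', le_div_iff₀ hθ0]
      nlinarith
    linarith
  set C := ε ^ (-(w₁ + w₂) / w₃) with hC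
  have hC0 : 0 < C := Real.rpow_pos_of_pos hε _
  have hCε : ε ^ w₁ * ε ^ w₂ * C ^ w₃ = 1 := by
    rw [hC, ← Real.rpow_mul hε.le, ← Real.rpow_add hε, ← Real.rpow_add hε,
      div_mul_cancel₀ _ h3.ne']
    simp
  refine ⟨C, hC0.le, fun h a s d hh ha hs hs1 hd => ?_⟩
  have ha1 : 0 ≤ a ^ (α - 1) := Real.rpow_nonneg ha _
  have ha2 : 0 ≤ a ^ (q + α) := Real.rpow_nonneg ha _
  have hhp : 0 ≤ h ^ p := Real.rpow_nonneg hh _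
  have hdθ : 0 ≤ d ^ θ := Real.rpow_nonneg hd _
  have hsk0 : 0 ≤ s ^ k := pow_nonneg hs _
  have hZ₁ : 0 ≤ a ^ (α - 1) * h ^ p * s ^ k := by positivity
  have hZ₂ : 0 ≤ a ^ (q + α) * s ^ k := by positivity
  have hY := Real.geom_mean_le_arith_mean3_weighted h1 h2 h3.le
    (mul_nonneg hε.le hZ₁) (mul_nonneg hε.le hZ₂) (mul_nonneg hC0.le hdθ) hsum
  have hw1 : w₁ ≤ 1 := by linarith
  have hw2 : w₂ ≤ 1 := by linarith
  have hw3 : w₃ ≤ 1 := by linarith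
  refine le_trans ?_ (hY.trans ?_)
  · have e1 : (ε * (a ^ (α - 1) * h ^ p * s ^ k)) ^ w₁ =
        ε ^ w₁ * (a ^ ((α - 1) * w₁) * h ^ (p - j) * s ^ (k * w₁)) := by
      rw [Real.mul_rpow hε.le hZ₁, Real.mul_rpow (by positivity) hsk0, Real.mul_rpow ha1 hhp,
        ← Real.rpow_mul ha, ← Real.rpow_mul hh, ← Real.rpow_natCast, ← Real.rpow_mul hs,
        mul_comm p, hpα]
    have e2 : (ε * (a ^ (q + α) * s ^ k)) ^ w₂ =
        ε ^ w₂ * (a ^ ((q + α) * w₂) * s ^ (k * w₂)) := by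
      rw [Real.mul_rpow hε.le hZ₂, Real.mul_rpow ha2 hsk0,
        ← Real.rpow_mul ha, ← Real.rpow_natCast, ← Real.rpow_mul hs]
    have e3 : (C * d ^ θ) ^ w₃ = C ^ w₃ * d ^ j := by
      rw [Real.mul_rpow hC0.le hdθ, ← Real.rpow_mul hd, hw₃, mul_div_cancel₀ _ hθ0.ne',
        Real.rpow_natCast]
    rw [e1, e2, e3]
    have e4 : ε ^ w₁ * (a ^ ((α - 1) * w₁) * h ^ (p - j) * s ^ (k * w₁)) *
        (ε ^ w₂ * (a ^ ((q + α) * w₂) * s ^ (k * w₂))) * (C ^ w₃ * d ^ j) =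
        h ^ (p - j) * a ^ (α - 1 + j) * s ^ (k * w₁ + k * w₂) * d ^ j := by
      rw [← hexp, Real.rpow_add_of_nonneg ha (mul_nonneg (by linarith) h1)
        (mul_nonneg hqα.le h2), Real.rpow_add_of_nonneg hs (by positivity) (by positivity)]
      linear_combination (a ^ ((α - 1) * w₁) * h ^ (p - j) * s ^ (k * w₁) *
        (a ^ ((q + α) * w₂) * s ^ (k * w₂)) * d ^ j) * hCε
    rw [e4]
    have hle : s ^ (k - j) ≤ s ^ (k * w₁ + k * w₂) := by
      rw [← Real.rpow_natCast]
      exact Real.rpow_le_rpow_of_exponent_ge' hs hs1 (by positivity) hsk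
    have : 0 ≤ h ^ (p - j) * a ^ (α - 1 + j) := by positivity
    gcongr
  · have i1 := mul_le_of_le_one_left (mul_nonneg hε.le hZ₁) hw1
    have i2 := mul_le_of_le_one_left (mul_nonneg hε.le hZ₂) hw2
    have i3 := mul_le_of_le_one_left (mul_nonneg hC0.le hdθ) hw3
    linarith

section FinslerNorm

variable {N : ℕ} {H : EuclideanSpace ℝ (Fin N) → ℝ}

namespace IsFinslerNorm

lemma map_zero (hH : IsFinslerNorm H) : H 0 = 0 := (hH.1 0).2 rfl

lemma nonneg (hH : IsFinslerNorm H) (x : EuclideanSpace ℝ (Fin N)) : 0 ≤ H x := by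
  have h1 := hH.2.2.1 x ((-1 : ℝ) • x)
  rw [hH.2.1] at h1
  simp [hH.map_zero] at h1
  linarith

lemma pos (hH : IsFinslerNorm H) {x : EuclideanSpace ℝ (Fin N)} (hx : x ≠ 0) : 0 < H x :=
  lt_of_le_of_ne (hH.nonneg x) fun h => hx ((hH.1 x).1 h.symm)

lemma exists_lipschitzWith (hH : IsFinslerNorm H) : ∃ M : NNReal, LipschitzWith M H := by
  have hsum : ∀ (s : Finset (Fin N)) (f : Fin N → EuclideanSpace ℝ (Fin N)),
      H (∑ i ∈ s, f i) ≤ ∑ i ∈ s, H (f i) := fun s f =>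
    Finset.le_sum_of_subadditive H hH.map_zero.le hH.2.2.1 s f
  let b := EuclideanSpace.basisFun (Fin N) ℝ
  have hbound : ∀ x, H x ≤ (∑ i, H (b i)) * ‖x‖ := by
    intro x
    calc H x = H (∑ i, b.repr x i • b i) := by rw [b.sum_repr]
      _ ≤ ∑ i, H (b.repr x i • b i) := hsum _ _
      _ ≤ ∑ i, H (b i) * ‖x‖ := by
        refine Finset.sum_le_sum fun i _ => ?_
        rw [hH.2.1, mul_comm]
        refine mul_le_mul_of_nonneg_left ?_ (hH.nonneg _)
        have := PiLp.norm_apply_le (b.repr x) i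
        rwa [b.repr.norm_map] at this
      _ = _ := by rw [Finset.sum_mul]
  refine ⟨⟨∑ i, H (b i), Finset.sum_nonneg fun i _ => hH.nonneg _⟩,
    LipschitzWith.of_le_add_mul _ fun x y => ?_⟩
  have h1 := hH.2.2.1 y (x - y)
  have h2 := hbound (x - y)
  rw [add_sub_cancel] at h1
  rw [dist_eq_norm]
  exact h1.trans (add_le_add_right h2 _)

lemma gradient_zero (hH : IsFinslerNorm H) : gradient H 0 = 0 := by
  have : IsLocalMin H 0 := Filter.Eventually.of_forall fun x => by
    rw [hH.map_zero]; exact hH.nonneg x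
  simp [gradient, this.fderiv_eq_zero]

lemma gradient_smul (hH : IsFinslerNorm H) {c : ℝ} (hc : 0 < c) (x : EuclideanSpace ℝ (Fin N)) :
    gradient H (c • x) = gradient H x := by
  have h1 := fderiv_comp_smul (𝕜 := ℝ) (f := H) (x := x) c
  have h2 : (fun x => H (c • x)) = c • H := by
    ext y; simp [hH.2.1, abs_of_pos hc]
  rw [h2, fderiv_const_smul_field] at h1
  have h3 : fderiv ℝ H (c • x) = fderiv ℝ H x := (smul_right_injective _ hc.ne' h1).symm
  simp [gradient, h3]

lemma hessian_smul (hH : IsFinslerNorm H) {c : ℝ} (hc : 0 < c) (x : EuclideanSpace ℝ (Fin N)) :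
    c • fderiv ℝ (gradient H) (c • x) = fderiv ℝ (gradient H) x := by
  rw [← fderiv_comp_smul (𝕜 := ℝ) (f := gradient H) (x := x) c]
  congr 1
  exact funext fun y => hH.gradient_smul hc y

lemma differentiableAt (hH : IsFinslerNorm H) {x : EuclideanSpace ℝ (Fin N)} (hx : x ≠ 0) :
    DifferentiableAt ℝ H x :=
  (hH.2.2.2.1.contDiffAt (isOpen_compl_singleton.mem_nhds hx)).differentiableAt (by norm_num)

lemma contDiffOn_gradient (hH : IsFinslerNorm H) :
    ContDiffOn ℝ 1 (gradient H) {(0 : EuclideanSpace ℝ (Fin N))}ᶜ := by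
  have h := hH.2.2.2.1.fderiv_of_isOpen (m := 1) isOpen_compl_singleton (by norm_num)
  exact (InnerProductSpace.toDual ℝ (EuclideanSpace ℝ (Fin N))).symm.toContinuousLinearEquiv.contDiff.comp_contDiffOn h

lemma differentiableAt_gradient (hH : IsFinslerNorm H) {x : EuclideanSpace ℝ (Fin N)}
    (hx : x ≠ 0) : DifferentiableAt ℝ (gradient H) x :=
  (hH.contDiffOn_gradient.contDiffAt (isOpen_compl_singleton.mem_nhds hx)).differentiableAt
    (by norm_num)

lemma inner_gradient_self (hH : IsFinslerNorm H) (x : EuclideanSpace ℝ (Fin N)) :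
    ⟪gradient H x, x⟫ = H x := by
  rcases eq_or_ne x 0 with rfl | hx
  · simp [hH.map_zero]
  rw [inner_gradient_left]
  have h1 : HasDerivAt (fun t : ℝ => H (t • x)) (fderiv ℝ H x x) 1 := by
    have hd : HasFDerivAt H (fderiv ℝ H x) ((1 : ℝ) • x) := by
      rw [one_smul]; exact (hH.differentiableAt hx).hasFDerivAt
    simpa [Function.comp_def] using hd.comp_hasDerivAt (1 : ℝ) ((hasDerivAt_id (1 : ℝ)).smul_const x)
  have h2 : HasDerivAt (fun t : ℝ => H (t • x)) (H x) 1 := by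
    have : HasDerivAt (fun t : ℝ => t * H x) (H x) 1 := by
      simpa using (hasDerivAt_id (1 : ℝ)).mul_const (H x)
    refine this.congr_of_eventuallyEq ?_
    filter_upwards [lt_mem_nhds (zero_lt_one (α := ℝ))] with t ht
    rw [hH.2.1, abs_of_pos ht]
  exact h1.unique h2

lemma hessian_self (hH : IsFinslerNorm H) {x : EuclideanSpace ℝ (Fin N)} (hx : x ≠ 0) :
    fderiv ℝ (gradient H) x x = 0 := by
  have h1 : HasDerivAt (fun t : ℝ => gradient H (t • x)) (fderiv ℝ (gradient H) x x) 1 := by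
    have hd : HasFDerivAt (gradient H) (fderiv ℝ (gradient H) x) ((1 : ℝ) • x) := by
      rw [one_smul]; exact (hH.differentiableAt_gradient hx).hasFDerivAt
    simpa [Function.comp_def] using hd.comp_hasDerivAt (1 : ℝ) ((hasDerivAt_id (1 : ℝ)).smul_const x)
  have h2 : HasDerivAt (fun t : ℝ => gradient H (t • x)) 0 1 := by
    refine (hasDerivAt_const (1 : ℝ) (gradient H x)).congr_of_eventuallyEq ?_
    filter_upwards [lt_mem_nhds (zero_lt_one (α := ℝ))] with t ht
    rw [hH.gradient_smul ht]
  exact h1.unique h2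

lemma inner_hessian_self (hH : IsFinslerNorm H) {x : EuclideanSpace ℝ (Fin N)} (hx : x ≠ 0)
    (v : EuclideanSpace ℝ (Fin N)) : ⟪fderiv ℝ (gradient H) x v, x⟫ = 0 := by
  have h1 := (hH.differentiableAt_gradient hx).hasFDerivAt.inner ℝ (hasFDerivAt_id x)
  have h2 := (hH.differentiableAt hx).hasFDerivAt
  have h3 : (fun y => ⟪gradient H y, id y⟫) = H := funext fun y => hH.inner_gradient_self y
  rw [h3] at h1
  have h4 := congrArg (fun L => L v) (h1.unique h2)
  simp [inner_gradient_left, fderivInnerCLM_apply] at h4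
  exact h4

lemma exists_hessian_bound (hH : IsFinslerNorm H) :
    ∃ K : ℝ, 0 ≤ K ∧ ∀ x ≠ 0, ∀ v,
      |⟪fderiv ℝ (gradient H) x v, v⟫| ≤ K / H x * ‖v‖ ^ 2 := by
  obtain ⟨M, hM⟩ := hH.exists_lipschitzWith
  have hcont := hH.contDiffOn_gradient.continuousOn_fderiv_of_isOpen isOpen_compl_singleton le_rfl
  obtain ⟨C, hC⟩ := (isCompact_sphere (0 : EuclideanSpace ℝ (Fin N)) 1).exists_bound_of_continuousOn
    (hcont.mono fun x hx h => by
      rw [Set.mem_singleton_iff] at h; simp [h] at hx)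
  refine ⟨|C| * M, by positivity, fun x hx v => ?_⟩
  have hx0 : 0 < ‖x‖ := norm_pos_iff.2 hx
  have hHx := hH.pos hx
  have hHM : H x ≤ M * ‖x‖ := by
    simpa [hH.map_zero, abs_of_nonneg (hH.nonneg x), Real.dist_eq, dist_eq_norm] using hM.dist_le_mul x 0
  have h1 : ‖fderiv ℝ (gradient H) x‖ ≤ |C| * M / H x := by
    rw [← hH.hessian_smul (inv_pos.2 hx0) x, norm_smul]
    have h2 := hC (‖x‖⁻¹ • x) (by simp [norm_smul, hx0.ne'])
    rw [Real.norm_of_nonneg (inv_nonneg.2 hx0.le)]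
    rw [le_div_iff₀ hHx]
    have h3 := h2.trans (le_abs_self C)
    calc ‖x‖⁻¹ * ‖fderiv ℝ (gradient H) (‖x‖⁻¹ • x)‖ * H x ≤ ‖x‖⁻¹ * |C| * (M * ‖x‖) := by gcongr
      _ = |C| * M := by field_simp
  calc |⟪fderiv ℝ (gradient H) x v, v⟫| ≤ ‖fderiv ℝ (gradient H) x v‖ * ‖v‖ :=
        abs_real_inner_le_norm _ _
    _ ≤ ‖fderiv ℝ (gradient H) x‖ * ‖v‖ * ‖v‖ := by
        gcongr; exact ContinuousLinearMap.le_opNorm _ _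
    _ ≤ |C| * M / H x * ‖v‖ * ‖v‖ := by gcongr
    _ = _ := by ring

lemma abs_inner_gradient_le {M : NNReal} (hM : LipschitzWith M H)
    (x v : EuclideanSpace ℝ (Fin N)) : |⟪gradient H x, v⟫| ≤ M * ‖v‖ := by
  rw [inner_gradient_left]
  exact (ContinuousLinearMap.le_opNorm _ _).trans
    (mul_le_mul_of_nonneg_right (norm_fderiv_le_of_lipschitz ℝ hM) (norm_nonneg _))

end IsFinslerNorm

end FinslerNorm

namespace SatisfiesHB

variable {B : ℝ → ℝ} {p γ Γ : ℝ}

lemma deriv_nonneg (hB : SatisfiesHB B p 0 γ Γ) {t : ℝ} (ht : 0 ≤ t) : 0 ≤ deriv B t := by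
  rcases ht.eq_or_lt with rfl | ht
  · exact hB.2.2.1.ge
  · exact (hB.2.2.2.1 t ht).2.1.le

lemma deriv_le (hB : SatisfiesHB B p 0 γ Γ) {t : ℝ} (ht : 0 ≤ t) :
    deriv B t ≤ Γ * t ^ (p - 1) := by
  obtain ⟨-, -, h0, -, hp, -, -, -, hΓ, h, -⟩ := hB
  rcases ht.eq_or_lt with rfl | ht
  · rw [h0]; positivity
  · refine (h t ht).2.trans_eq ?_
    rw [zero_add, mul_assoc, ← Real.rpow_add_one ht.ne']
    congr 2; ring

lemma le_deriv_mul_self (hB : SatisfiesHB B p 0 γ Γ) {t : ℝ} (ht : 0 ≤ t) :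
    γ * t ^ p ≤ deriv B t * t := by
  obtain ⟨-, -, h0, -, hp, -, -, -, hΓ, h, -⟩ := hB
  rcases ht.eq_or_lt with rfl | ht
  · rw [h0, Real.zero_rpow (by linarith)]; simp
  · have h1 := mul_le_mul_of_nonneg_right (h t ht).1 ht.le
    refine le_trans (le_of_eq ?_) h1
    rw [zero_add, mul_assoc, mul_assoc, ← sq, ← Real.rpow_natCast t 2, ← Real.rpow_add ht]
    congr 2; push_cast; ring

lemma deriv_deriv_le (hB : SatisfiesHB B p 0 γ Γ) {t : ℝ} (ht : 0 < t) :
    deriv (deriv B) t ≤ Γ * (p - 1) * t ^ (p - 2) := by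
  simpa using (hB.2.2.2.2.2.2.2.2.2.2 t ht).2

lemma deriv_deriv_mul_sq_le (hB : SatisfiesHB B p 0 γ Γ) {t : ℝ} (ht : 0 < t) :
    deriv (deriv B) t * t ^ 2 ≤ Γ * γ⁻¹ * (p - 1) * (deriv B t * t) := by
  have h1 := hB.le_deriv_mul_self ht.le
  have h2 := mul_le_mul_of_nonneg_right (hB.deriv_deriv_le ht) (sq_nonneg t)
  obtain ⟨-, -, -, -, hp, -, -, hγ, hΓ, -⟩ := hB
  have h3 : t ^ (p - 2) * t ^ 2 = t ^ p := by
    rw [← Real.rpow_natCast t 2, ← Real.rpow_add ht]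
    congr 1; push_cast; ring
  have h4 : t ^ p ≤ γ⁻¹ * (deriv B t * t) := by
    rw [inv_mul_eq_div, le_div_iff₀ hγ]; linarith
  calc _ ≤ Γ * (p - 1) * (t ^ (p - 2) * t ^ 2) := by linarith
    _ ≤ Γ * (p - 1) * (γ⁻¹ * (deriv B t * t)) := by
      rw [h3]; exact mul_le_mul_of_nonneg_left h4 (mul_nonneg hΓ.le (by linarith))
    _ = _ := by ring

lemma one_le_ratio (hB : SatisfiesHB B p 0 γ Γ) : 1 ≤ Γ * γ⁻¹ := by
  have h1 := hB.le_deriv_mul_self zero_le_one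
  have h2 := hB.deriv_le zero_le_one
  simp only [Real.one_rpow, mul_one] at h1 h2
  rw [← div_eq_mul_inv, one_le_div hB.2.2.2.2.2.2.2.1]
  linarith

end SatisfiesHB

section Pointwise

variable {N : ℕ} {H : EuclideanSpace ℝ (Fin N) → ℝ} {B : ℝ → ℝ} {p γ Γ : ℝ}

lemma flux_pairing_bound (hH : IsFinslerNorm H) (hB : SatisfiesHB B p 0 γ Γ)
    {M : NNReal} (hM : LipschitzWith M H) (ξ v : EuclideanSpace ℝ (Fin N)) (A b : ℝ) :
    |deriv B (H ξ) * ⟪gradient H ξ, A • ξ + b • v⟫ - A * (deriv B (H ξ) * H ξ)| ≤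
      Γ * M * (|b| * H ξ ^ (p - 1) * ‖v‖) := by
  have h0 := hB.deriv_nonneg (hH.nonneg ξ)
  have h1 := hB.deriv_le (hH.nonneg ξ)
  have h2 := IsFinslerNorm.abs_inner_gradient_le hM ξ v
  rw [inner_add_right, inner_smul_right, inner_smul_right, hH.inner_gradient_self]
  have : deriv B (H ξ) * (A * H ξ + b * ⟪gradient H ξ, v⟫) - A * (deriv B (H ξ) * H ξ) =
      deriv B (H ξ) * (b * ⟪gradient H ξ, v⟫) := by ring
  rw [this, abs_mul, abs_mul, abs_of_nonneg h0]
  calc deriv B (H ξ) * (|b| * |⟪gradient H ξ, v⟫|)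
      ≤ (Γ * H ξ ^ (p - 1)) * (|b| * (M * ‖v‖)) := by gcongr; exact h0.trans h1
    _ = _ := by ring

lemma radial_stability_bound (hH : IsFinslerNorm H) (hB : SatisfiesHB B p 0 γ Γ)
    {M : NNReal} (hM : LipschitzWith M H) (ξ v : EuclideanSpace ℝ (Fin N)) (A b : ℝ) :
    deriv (deriv B) (H ξ) * ⟪gradient H ξ, A • ξ + b • v⟫ ^ 2 ≤
      Γ * γ⁻¹ * (p - 1) * A ^ 2 * (deriv B (H ξ) * H ξ)
        + 2 * (Γ * (p - 1) * M) * (|A| * |b| * H ξ ^ (p - 1) * ‖v‖)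
        + Γ * (p - 1) * M ^ 2 * (b ^ 2 * H ξ ^ (p - 2) * ‖v‖ ^ 2) := by
  have hp : 0 < p - 1 := by linarith [hB.2.2.2.2.1]
  have hγ : 0 < γ := hB.2.2.2.2.2.2.2.1
  have hΓ : 0 < Γ := hB.2.2.2.2.2.2.2.2.1
  have hh := hH.nonneg ξ
  rcases eq_or_ne ξ 0 with rfl | hξ
  · rw [hH.gradient_zero]
    have h0 := hB.deriv_nonneg hh
    simp only [inner_zero_left]
    rw [zero_pow two_ne_zero, mul_zero]
    positivity
  have hpos := hH.pos hξ
  have h0 : 0 ≤ deriv (deriv B) (H ξ) := (hB.2.2.2.1 _ hpos).2.2.le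
  have h1 := hB.deriv_deriv_le hpos
  have h2 := hB.deriv_deriv_mul_sq_le hpos
  have h3 := IsFinslerNorm.abs_inner_gradient_le hM ξ v
  rw [inner_add_right, inner_smul_right, inner_smul_right, hH.inner_gradient_self]
  set e := ⟪gradient H ξ, v⟫
  have hpow : H ξ ^ (p - 1) = H ξ ^ (p - 2) * H ξ := by
    rw [← Real.rpow_add_one hpos.ne']; congr 1; ring
  have hcross : deriv (deriv B) (H ξ) * (2 * (A * H ξ) * (b * e)) ≤
      2 * (Γ * (p - 1) * M) * (|A| * |b| * H ξ ^ (p - 1) * ‖v‖) := by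
    calc deriv (deriv B) (H ξ) * (2 * (A * H ξ) * (b * e))
        ≤ |deriv (deriv B) (H ξ) * (2 * (A * H ξ) * (b * e))| := le_abs_self _
      _ = deriv (deriv B) (H ξ) * (2 * (|A| * H ξ) * (|b| * |e|)) := by
        simp only [abs_mul, abs_of_nonneg h0, abs_of_nonneg hh, abs_two]
      _ ≤ (Γ * (p - 1) * H ξ ^ (p - 2)) * (2 * (|A| * H ξ) * (|b| * (M * ‖v‖))) := by
        gcongr
      _ = _ := by rw [hpow]; ring
  have hquad : deriv (deriv B) (H ξ) * (b * e) ^ 2 ≤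
      Γ * (p - 1) * M ^ 2 * (b ^ 2 * H ξ ^ (p - 2) * ‖v‖ ^ 2) := by
    calc deriv (deriv B) (H ξ) * (b * e) ^ 2 = deriv (deriv B) (H ξ) * (b ^ 2 * |e| ^ 2) := by
          rw [sq_abs]; ring
      _ ≤ (Γ * (p - 1) * H ξ ^ (p - 2)) * (b ^ 2 * (M * ‖v‖) ^ 2) := by gcongr
      _ = _ := by ring
  have hmain := mul_le_mul_of_nonneg_left h2 (sq_nonneg A)
  linarith

lemma tangential_stability_bound (hH : IsFinslerNorm H) (hB : SatisfiesHB B p 0 γ Γ) {K : ℝ}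
    (hK0 : 0 ≤ K)
    (hK : ∀ x ≠ 0, ∀ v, |⟪fderiv ℝ (gradient H) x v, v⟫| ≤ K / H x * ‖v‖ ^ 2)
    (ξ v : EuclideanSpace ℝ (Fin N)) (A b : ℝ) :
    |deriv B (H ξ) * ⟪fderiv ℝ (gradient H) ξ (A • ξ + b • v), A • ξ + b • v⟫| ≤
      Γ * K * (b ^ 2 * H ξ ^ (p - 2) * ‖v‖ ^ 2) := by
  have hΓ : 0 < Γ := hB.2.2.2.2.2.2.2.2.1
  have hh := hH.nonneg ξ
  rcases eq_or_ne ξ 0 with rfl | hξ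
  · rw [hH.map_zero, hB.2.2.1, zero_mul, abs_zero]
    positivity
  have hpos := hH.pos hξ
  have h0 := hB.deriv_nonneg hh
  have h1 := hB.deriv_le hh
  have h2 := hK ξ hξ v
  have hpow : H ξ ^ (p - 1) = H ξ ^ (p - 2) * H ξ := by
    rw [← Real.rpow_add_one hpos.ne']; congr 1; ring
  have hquad : ⟪fderiv ℝ (gradient H) ξ (A • ξ + b • v), A • ξ + b • v⟫ =
      b ^ 2 * ⟪fderiv ℝ (gradient H) ξ v, v⟫ := by
    rw [map_add, map_smul, map_smul, hH.hessian_self hξ, smul_zero, zero_add, inner_add_right,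
      inner_smul_right, inner_smul_left, inner_smul_left, inner_smul_right,
      hH.inner_hessian_self hξ]
    simp only [conj_trivial]
    ring
  rw [hquad, abs_mul, abs_mul, abs_of_nonneg h0, abs_of_nonneg (sq_nonneg b)]
  calc deriv B (H ξ) * (b ^ 2 * |⟪fderiv ℝ (gradient H) ξ v, v⟫|)
      ≤ (Γ * H ξ ^ (p - 1)) * (b ^ 2 * (K / H ξ * ‖v‖ ^ 2)) := by gcongr
    _ = _ := by rw [hpow]; field_simp

end Pointwise

section Calculus

variable {N : ℕ} {u ψ : EuclideanSpace ℝ (Fin N) → ℝ}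

lemma continuous_gradient (hu : ContDiff ℝ 1 u) : Continuous (gradient u) :=
  (InnerProductSpace.toDual ℝ (EuclideanSpace ℝ (Fin N))).symm.continuous.comp
    (hu.continuous_fderiv (by norm_num))

lemma gradient_signed_power_mul_pow (hu : ContDiff ℝ 1 u) (hψ : ContDiff ℝ 1 ψ) {r : ℝ}
    (hr : 0 < r) (n : ℕ) (x : EuclideanSpace ℝ (Fin N)) :
    gradient (fun x => |u x| ^ r * u x * ψ x ^ n) x =
      ((r + 1) * |u x| ^ r * ψ x ^ n) • gradient u x
        + (|u x| ^ r * u x * (n * ψ x ^ (n - 1))) • gradient ψ x := by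
  have h1 : HasFDerivAt u (fderiv ℝ u x) x :=
    (hu.differentiable (by norm_num) x).hasFDerivAt
  have h2 : HasFDerivAt ψ (fderiv ℝ ψ x) x :=
    (hψ.differentiable (by norm_num) x).hasFDerivAt
  have h3 := (hasDerivAt_abs_rpow_mul_self hr (u x)).comp_hasFDerivAt x h1
  have h4 := h3.mul (h2.pow n)
  have h5 : fderiv ℝ (fun x => |u x| ^ r * u x * ψ x ^ n) x = _ := h4.fderiv
  rw [gradient, h5]
  simp only [gradient, map_add, map_smul, smul_smul, Function.comp_apply]
  rw [add_comm]
  congr 2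
  · ring
  · simp

lemma contDiff_signed_power_mul_pow (hu : ContDiff ℝ 1 u) (hψ : ContDiff ℝ 1 ψ) {r : ℝ}
    (hr : 0 < r) (n : ℕ) : ContDiff ℝ 1 (fun x => |u x| ^ r * u x * ψ x ^ n) :=
  ((contDiff_abs_rpow_mul_self hr).comp hu).mul (hψ.pow n)

lemma hasCompactSupport_of_zero {f : EuclideanSpace ℝ (Fin N) → ℝ} (hψ : HasCompactSupport ψ)
    (h : ∀ x, ψ x = 0 → f x = 0) : HasCompactSupport f :=
  hψ.mono fun x hx hx' => hx (h x hx')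

end Calculus

section Energy

variable {N : ℕ} {H u ψ : EuclideanSpace ℝ (Fin N) → ℝ} {B : ℝ → ℝ} {p γ Γ q α : ℝ} {m : ℕ}

/-- The mixed term `H(∇u)^{p-j} |u|^{α-1+j} ψ^{2m-j} |∇ψ|^j` of the energy estimate. -/
def mixedTerm (H u ψ : EuclideanSpace ℝ (Fin N) → ℝ) (p α : ℝ) (m j : ℕ)
    (x : EuclideanSpace ℝ (Fin N)) : ℝ :=
  H (gradient u x) ^ (p - j) * |u x| ^ (α - 1 + j) * ψ x ^ (2 * m - j) * ‖gradient ψ x‖ ^ j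

/-- The energy density `|u|^{α-1} B'(H(∇u)) H(∇u) ψ^{2m}`. -/
def energyDensity (H u ψ : EuclideanSpace ℝ (Fin N) → ℝ) (B : ℝ → ℝ) (α : ℝ) (m : ℕ)
    (x : EuclideanSpace ℝ (Fin N)) : ℝ :=
  |u x| ^ (α - 1) * ψ x ^ (2 * m) * (deriv B (H (gradient u x)) * H (gradient u x))

lemma continuous_mixedTerm (hHc : Continuous H) (hu : ContDiff ℝ 1 u) (hψ : ContDiff ℝ 1 ψ)
    (hα : 1 < α) {j : ℕ} (hj : (j : ℝ) ≤ p) : Continuous (mixedTerm H u ψ p α m j) := by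
  have h1 := continuous_gradient hu
  have h2 := continuous_gradient hψ
  have h3 := hu.continuous
  have h4 := hψ.continuous
  refine ((((hHc.comp h1).rpow_const fun _ => Or.inr (by linarith)).mul
    (h3.abs.rpow_const fun _ => Or.inr ?_)).mul (h4.pow _)).mul (h2.norm.pow _)
  have : (0 : ℝ) ≤ j := Nat.cast_nonneg j
  linarith

lemma integrable_mixedTerm (hHc : Continuous H) (hu : ContDiff ℝ 1 u) (hψ : ContDiff ℝ 1 ψ)
    (hψc : HasCompactSupport ψ) (hα : 1 < α) {j : ℕ} (hj : (j : ℝ) ≤ p) (hjm : j < 2 * m) :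
    Integrable (mixedTerm H u ψ p α m j) :=
  (continuous_mixedTerm hHc hu hψ hα hj).integrable_of_hasCompactSupport <|
    hasCompactSupport_of_zero hψc fun x hx => by
      simp [mixedTerm, hx, Nat.sub_ne_zero_of_lt hjm]

lemma integrable_power_density (hHc : Continuous H) (hu : ContDiff ℝ 1 u) (hψ : ContDiff ℝ 1 ψ)
    (hψc : HasCompactSupport ψ) (hp : 0 < p) (hα : 1 < α) (hm : 0 < m) :
    Integrable fun x => |u x| ^ (α - 1) * H (gradient u x) ^ p * ψ x ^ (2 * m) := by
  have h1 := continuous_gradient hu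
  refine Continuous.integrable_of_hasCompactSupport ?_ (hasCompactSupport_of_zero hψc fun x hx => ?_)
  · exact ((hu.continuous.abs.rpow_const fun _ => Or.inr (by linarith)).mul
      ((hHc.comp h1).rpow_const fun _ => Or.inr hp.le)).mul (hψ.continuous.pow _)
  · simp [hx, hm.ne']

lemma continuous_potential_density (hu : ContDiff ℝ 1 u) (hψ : ContDiff ℝ 1 ψ) {s : ℝ}
    (hs : 0 ≤ s) : Continuous fun x => |u x| ^ s * ψ x ^ (2 * m) :=
  (hu.continuous.abs.rpow_const fun _ => Or.inr hs).mul (hψ.continuous.pow _)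

lemma hasCompactSupport_potential_density (hψc : HasCompactSupport ψ) (hm : 0 < m) (s : ℝ) :
    HasCompactSupport fun x => |u x| ^ s * ψ x ^ (2 * m) :=
  hasCompactSupport_of_zero hψc fun x hx => by simp [hx, hm.ne']

lemma integrable_potential_density (hu : ContDiff ℝ 1 u) (hψ : ContDiff ℝ 1 ψ)
    (hψc : HasCompactSupport ψ) (hm : 0 < m) {s : ℝ} (hs : 0 ≤ s) :
    Integrable fun x => |u x| ^ s * ψ x ^ (2 * m) :=
  (continuous_potential_density hu hψ hs).integrable_of_hasCompactSupport
    (hasCompactSupport_potential_density hψc hm s)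

lemma energyDensity_nonneg (hH : IsFinslerNorm H) (hB : SatisfiesHB B p 0 γ Γ)
    (x : EuclideanSpace ℝ (Fin N)) : 0 ≤ energyDensity H u ψ B α m x := by
  have h1 := hH.nonneg (gradient u x)
  have h2 := hB.deriv_nonneg h1
  have h3 : 0 ≤ ψ x ^ (2 * m) := (even_two_mul m).pow_nonneg _
  unfold energyDensity
  positivity

lemma power_density_le_energyDensity (hH : IsFinslerNorm H) (hB : SatisfiesHB B p 0 γ Γ)
    (x : EuclideanSpace ℝ (Fin N)) :
    γ * (|u x| ^ (α - 1) * H (gradient u x) ^ p * ψ x ^ (2 * m)) ≤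
      energyDensity H u ψ B α m x := by
  have h1 := hB.le_deriv_mul_self (hH.nonneg (gradient u x))
  have h3 : 0 ≤ ψ x ^ (2 * m) := (even_two_mul m).pow_nonneg _
  have h4 : 0 ≤ |u x| ^ (α - 1) * ψ x ^ (2 * m) := by positivity
  have := mul_le_mul_of_nonneg_left h1 h4
  unfold energyDensity
  linarith

lemma energyDensity_le (hH : IsFinslerNorm H) (hB : SatisfiesHB B p 0 γ Γ)
    (x : EuclideanSpace ℝ (Fin N)) : energyDensity H u ψ B α m x ≤
      Γ * (|u x| ^ (α - 1) * H (gradient u x) ^ p * ψ x ^ (2 * m)) := by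
  have hp := hB.2.2.2.2.1
  have hh := hH.nonneg (gradient u x)
  have h1 := mul_le_mul_of_nonneg_right (hB.deriv_le hh) hh
  have h3 : 0 ≤ ψ x ^ (2 * m) := (even_two_mul m).pow_nonneg _
  have h4 : 0 ≤ |u x| ^ (α - 1) * ψ x ^ (2 * m) := by positivity
  have h5 : H (gradient u x) ^ p = H (gradient u x) ^ (p - 1) * H (gradient u x) := by
    rw [← Real.rpow_add_one' hh (by linarith)]; congr 1; ring
  have := mul_le_mul_of_nonneg_left h1 h4
  unfold energyDensity
  rw [h5]
  linarith

lemma integrable_energyDensity (hH : IsFinslerNorm H) (hHc : Continuous H)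
    (hB : SatisfiesHB B p 0 γ Γ) (hu : ContDiff ℝ 1 u)
    (hψ : ContDiff ℝ 1 ψ) (hψc : HasCompactSupport ψ) (hα : 1 < α) (hm : 0 < m) :
    Integrable (energyDensity H u ψ B α m) := by
  have hp : 0 < p := by linarith [hB.2.2.2.2.1]
  refine ((integrable_power_density (m := m) hHc hu hψ hψc hp hα hm).const_mul Γ).mono' ?_
    (Filter.Eventually.of_forall fun x => ?_)
  · have h1 : Measurable fun x => H (gradient u x) := (hHc.comp (continuous_gradient hu)).measurable
    have h2 : Measurable fun x => |u x| ^ (α - 1) * ψ x ^ (2 * m) :=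
      (continuous_potential_density hu hψ (by linarith)).measurable
    exact (h2.mul (((measurable_deriv B).comp h1).mul h1)).aestronglyMeasurable
  · rw [Real.norm_of_nonneg (energyDensity_nonneg hH hB x)]
    exact energyDensity_le hH hB x

lemma measurable_flux_pairing (hu : ContDiff ℝ 1 u)
    {φ : EuclideanSpace ℝ (Fin N) → ℝ} (hφ : ContDiff ℝ 1 φ) :
    Measurable fun x => ⟪gradient H (gradient u x), gradient φ x⟫ := by
  have h1 := (continuous_gradient hu).measurable
  have h2 := (continuous_gradient hφ).measurable
  have h3 : Measurable (gradient H) :=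
    (InnerProductSpace.toDual ℝ (EuclideanSpace ℝ (Fin N))).symm.continuous.measurable.comp
      (measurable_fderiv ℝ H)
  exact (h3.comp h1).inner h2

lemma abs_rpow_mul_self_abs {r : ℝ} (hr : 0 < r) (t : ℝ) :
    |(|t| ^ r * t)| = |t| ^ (r + 1) := by
  rw [abs_mul, abs_of_nonneg (Real.rpow_nonneg (abs_nonneg t) r),
    Real.rpow_add_one' (abs_nonneg t) (by linarith)]

/-- Testing the equation with `|u|^{α-1} u ψ^{2m}`. -/
lemma weak_solution_energy (hH : IsFinslerNorm H) (hB : SatisfiesHB B p 0 γ Γ)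
    {M : NNReal} (hM : LipschitzWith M H) (hp : 2 ≤ p) (hq : 1 < q) (hu : ContDiff ℝ 1 u)
    (hsol : IsWeakSolutionOn Set.univ B H u q) (hα : 1 < α) (hm : 0 < m)
    (hψ : ContDiff ℝ 1 ψ) (hψc : HasCompactSupport ψ) (hψ0 : ∀ x, 0 ≤ ψ x) :
    |α * (∫ x, energyDensity H u ψ B α m x) - ∫ x, |u x| ^ (q + α) * ψ x ^ (2 * m)| ≤
      Γ * M * (2 * m) * ∫ x, mixedTerm H u ψ p α m 1 x := by
  have hHc := hM.continuous
  have hr : 0 < α - 1 := by linarith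
  set φ : EuclideanSpace ℝ (Fin N) → ℝ := fun x => |u x| ^ (α - 1) * u x * ψ x ^ (2 * m) with hφ
  have hφd : ContDiff ℝ 1 φ := contDiff_signed_power_mul_pow hu hψ hr _
  have hφc : HasCompactSupport φ := hasCompactSupport_of_zero hψc fun x hx => by
    simp [hφ, hx, hm.ne']
  have hgrad := gradient_signed_power_mul_pow hu hψ hr (2 * m)
  have hw := hsol φ hφd hφc (Set.subset_univ _)
  simp only [Measure.restrict_univ] at hw
  have hrhs : (fun x => |u x| ^ (q - 1) * u x * φ x) =
      fun x => |u x| ^ (q + α) * ψ x ^ (2 * m) := by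
    funext x
    have h1 : |u x| ^ (q + α) = |u x| ^ (q - 1) * |u x| ^ (α - 1) * |u x| ^ 2 := by
      rw [← Real.rpow_natCast, ← Real.rpow_add_of_nonneg (abs_nonneg _) (by linarith) (by linarith),
        ← Real.rpow_add_of_nonneg (abs_nonneg _) (by linarith) (by norm_num)]
      congr 1; push_cast; ring
    rw [h1, sq_abs]; simp only [hφ]; ring
  rw [hrhs] at hw
  have hG := integrable_energyDensity (m := m) hH hHc hB hu hψ hψc hα hm
  have hE := integrable_mixedTerm (p := p) (m := m) hHc hu hψ hψc hα (j := 1)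
    (by push_cast; linarith) (by lia)
  set I : EuclideanSpace ℝ (Fin N) → ℝ := fun x =>
    deriv B (H (gradient u x)) * ⟪gradient H (gradient u x), gradient φ x⟫ with hI
  have hpt : ∀ x, ‖I x - α * energyDensity H u ψ B α m x‖ ≤
      Γ * M * (2 * m) * mixedTerm H u ψ p α m 1 x := by
    intro x
    have h := flux_pairing_bound hH hB hM (gradient u x) (gradient ψ x)
      ((α - 1 + 1) * |u x| ^ (α - 1) * ψ x ^ (2 * m))
      (|u x| ^ (α - 1) * u x * ((2 * m : ℕ) * ψ x ^ (2 * m - 1)))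
    rw [← hgrad x] at h
    have hb : |(|u x| ^ (α - 1) * u x * ((2 * m : ℕ) * ψ x ^ (2 * m - 1)))| =
        |u x| ^ (α - 1 + 1) * (2 * m * ψ x ^ (2 * m - 1)) := by
      rw [abs_mul, abs_rpow_mul_self_abs hr, abs_of_nonneg (a := _ * ψ x ^ _)]
      · push_cast; ring
      · have := hψ0 x; positivity
    rw [hb] at h
    rw [Real.norm_eq_abs]
    convert h using 1
    · simp only [hI, energyDensity]; congr 1; ring
    · simp only [mixedTerm]; push_cast; ring
  have hIm : AEStronglyMeasurable I := by
    refine Measurable.aestronglyMeasurable (Measurable.mul ?_ (measurable_flux_pairing hu hφd))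
    exact (measurable_deriv B).comp (hHc.comp (continuous_gradient hu)).measurable
  have hdiff : Integrable fun x => I x - α * energyDensity H u ψ B α m x :=
    (hE.const_mul _).mono' (hIm.sub (hG.const_mul α).aestronglyMeasurable)
      (Filter.Eventually.of_forall hpt)
  have hIi : Integrable I := by
    have := hdiff.add (hG.const_mul α)
    refine this.congr (Filter.Eventually.of_forall fun x => ?_)
    simp
  have hle := norm_integral_le_of_norm_le (hE.const_mul (Γ * M * (2 * m)))
    (Filter.Eventually.of_forall hpt)
  rw [integral_sub hIi (hG.const_mul α), integral_const_mul, integral_const_mul, hw,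
    Real.norm_eq_abs, abs_sub_comm] at hle
  exact hle

/-- Testing the stability inequality with `|u|^{(α-1)/2} u ψ^m`. -/
lemma stability_energy (hH : IsFinslerNorm H) (hB : SatisfiesHB B p 0 γ Γ)
    {M : NNReal} (hM : LipschitzWith M H) {K : ℝ} (hK0 : 0 ≤ K)
    (hK : ∀ x ≠ 0, ∀ v, |⟪fderiv ℝ (gradient H) x v, v⟫| ≤ K / H x * ‖v‖ ^ 2)
    (hp : 2 ≤ p) (hq : 1 < q) (hu : ContDiff ℝ 1 u)
    (hstab : IsStableOn Set.univ Set.univ B H u q) (hα : 1 < α) (hm : 2 ≤ m)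
    (hψ : ContDiff ℝ 1 ψ) (hψc : HasCompactSupport ψ) (hψ0 : ∀ x, 0 ≤ ψ x) :
    q * (∫ x, |u x| ^ (q + α) * ψ x ^ (2 * m)) ≤
      Γ * γ⁻¹ * (p - 1) * ((α + 1) / 2) ^ 2 * (∫ x, energyDensity H u ψ B α m x)
        + Γ * (p - 1) * M * (α + 1) * m * (∫ x, mixedTerm H u ψ p α m 1 x)
        + (Γ * (p - 1) * M ^ 2 + Γ * K) * m ^ 2 * (∫ x, mixedTerm H u ψ p α m 2 x) := by
  have hHc := hM.continuous
  have hr : 0 < (α - 1) / 2 := by linarith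
  have hm0 : 0 < m := by lia
  set φ : EuclideanSpace ℝ (Fin N) → ℝ := fun x => |u x| ^ ((α - 1) / 2) * u x * ψ x ^ m with hφ
  have hφd : ContDiff ℝ 1 φ := contDiff_signed_power_mul_pow hu hψ hr _
  have hφc : HasCompactSupport φ := hasCompactSupport_of_zero hψc fun x hx => by
    simp [hφ, hx, hm0.ne']
  have hgrad := gradient_signed_power_mul_pow hu hψ hr m
  have hs := hstab φ hφd hφc (Set.subset_univ _)
  simp only [Measure.restrict_univ] at hs
  have hhalf : ∀ x, (|u x| ^ ((α - 1) / 2)) ^ 2 = |u x| ^ (α - 1) := fun x => by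
    rw [← Real.rpow_natCast, ← Real.rpow_mul (abs_nonneg _)]
    congr 1; push_cast; ring
  have hrhs : (fun x => q * |u x| ^ (q - 1) * φ x ^ 2) =
      fun x => q * (|u x| ^ (q + α) * ψ x ^ (2 * m)) := by
    funext x
    have h1 : |u x| ^ (q + α) = |u x| ^ (q - 1) * |u x| ^ (α - 1) * |u x| ^ 2 := by
      rw [← Real.rpow_natCast, ← Real.rpow_add_of_nonneg (abs_nonneg _) (by linarith) (by linarith),
        ← Real.rpow_add_of_nonneg (abs_nonneg _) (by linarith) (by norm_num)]
      congr 1; push_cast; ring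
    rw [h1, sq_abs, ← hhalf]; simp only [hφ]; ring
  rw [hrhs, integral_const_mul] at hs
  have hG := integrable_energyDensity (m := m) hH hHc hB hu hψ hψc hα hm0
  have hE1 := integrable_mixedTerm (p := p) (m := m) hHc hu hψ hψc hα (j := 1)
    (by push_cast; linarith) (by lia)
  have hE2 := integrable_mixedTerm (p := p) (m := m) hHc hu hψ hψc hα (j := 2)
    (by push_cast; linarith) (by lia)
  set A : EuclideanSpace ℝ (Fin N) → ℝ := fun x =>
    ((α - 1) / 2 + 1) * |u x| ^ ((α - 1) / 2) * ψ x ^ m with hA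
  set b : EuclideanSpace ℝ (Fin N) → ℝ := fun x =>
    |u x| ^ ((α - 1) / 2) * u x * (m * ψ x ^ (m - 1)) with hb
  have hAsq : ∀ x, A x ^ 2 = ((α + 1) / 2) ^ 2 * (|u x| ^ (α - 1) * ψ x ^ (2 * m)) := fun x => by
    rw [← hhalf]; simp only [hA]; ring
  have hbabs : ∀ x, |b x| = |u x| ^ ((α - 1) / 2) * |u x| * (m * ψ x ^ (m - 1)) := fun x => by
    have h1 : 0 ≤ (m : ℝ) * ψ x ^ (m - 1) := by have := hψ0 x; positivity
    simp only [hb]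
    rw [abs_mul, abs_mul, abs_of_nonneg h1, abs_of_nonneg (Real.rpow_nonneg (abs_nonneg _) _)]
  have hAb : ∀ x, |A x| * |b x| =
      (α + 1) / 2 * m * (|u x| ^ (α - 1 + 1) * ψ x ^ (2 * m - 1)) := fun x => by
    have h1 : 0 ≤ A x := by
      have := hψ0 x
      have : 0 ≤ (α - 1) / 2 + 1 := by linarith
      simp only [hA]; positivity
    have h2 : 2 * m - 1 = m + (m - 1) := by lia
    rw [hbabs, abs_of_nonneg h1, Real.rpow_add_one' (abs_nonneg _) (by linarith), ← hhalf, h2,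
      pow_add]
    simp only [hA]; ring
  have hbsq : ∀ x, b x ^ 2 = m ^ 2 * (|u x| ^ (α - 1 + (2 : ℕ)) * ψ x ^ (2 * m - 2)) := fun x => by
    have h2 : 2 * m - 2 = (m - 1) * 2 := by lia
    rw [Real.rpow_add_of_nonneg (abs_nonneg _) (by linarith) (by norm_num), Real.rpow_natCast,
      ← hhalf, h2, pow_mul, sq_abs]
    simp only [hb]; ring
  have hφgrad : ∀ x, gradient φ x = A x • gradient u x + b x • gradient ψ x := hgrad
  set F₁ : EuclideanSpace ℝ (Fin N) → ℝ := fun x => deriv (deriv B) (H (gradient u x)) *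
    ⟪gradient H (gradient u x), gradient φ x⟫ ^ 2 with hF₁
  set F₂ : EuclideanSpace ℝ (Fin N) → ℝ := fun x => deriv B (H (gradient u x)) *
    ⟪fderiv ℝ (gradient H) (gradient u x) (gradient φ x), gradient φ x⟫ with hF₂
  set G₁ : EuclideanSpace ℝ (Fin N) → ℝ := fun x =>
    Γ * γ⁻¹ * (p - 1) * ((α + 1) / 2) ^ 2 * energyDensity H u ψ B α m x
      + Γ * (p - 1) * M * (α + 1) * m * mixedTerm H u ψ p α m 1 x
      + Γ * (p - 1) * M ^ 2 * m ^ 2 * mixedTerm H u ψ p α m 2 x with hG₁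
  have hpt₁ : ∀ x, F₁ x ≤ G₁ x := fun x => by
    have h := radial_stability_bound hH hB hM (gradient u x) (gradient ψ x) (A x) (b x)
    rw [← hφgrad, hAsq, hAb, hbsq] at h
    refine h.trans_eq ?_
    simp only [hG₁, energyDensity, mixedTerm]; push_cast; ring
  have hpt₂ : ∀ x, ‖F₂ x‖ ≤ Γ * K * m ^ 2 * mixedTerm H u ψ p α m 2 x := fun x => by
    have h := tangential_stability_bound hH hB hK0 hK (gradient u x) (gradient ψ x) (A x) (b x)
    rw [← hφgrad, hbsq] at h
    refine h.trans_eq ?_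
    simp only [mixedTerm]; push_cast; ring
  have hF₁0 : ∀ x, 0 ≤ F₁ x := fun x => by
    rcases eq_or_ne (gradient u x) 0 with h | h
    · simp [hF₁, h, hH.gradient_zero]
    · exact mul_nonneg (hB.2.2.2.1 _ (hH.pos h)).2.2.le (sq_nonneg _)
  have hhm : Measurable fun x => H (gradient u x) :=
    (hHc.comp (continuous_gradient hu)).measurable
  have hG₁i' : Integrable fun x =>
      Γ * γ⁻¹ * (p - 1) * ((α + 1) / 2) ^ 2 * energyDensity H u ψ B α m x
        + Γ * (p - 1) * M * (α + 1) * m * mixedTerm H u ψ p α m 1 x :=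
    (hG.const_mul _).add (hE1.const_mul _)
  have hG₁i : Integrable G₁ := hG₁i'.add (hE2.const_mul _)
  have hF₁i : Integrable F₁ := by
    refine hG₁i.mono' (Measurable.aestronglyMeasurable ?_) (Filter.Eventually.of_forall fun x => ?_)
    · exact ((measurable_deriv (deriv B)).comp hhm).mul
        ((measurable_flux_pairing hu hφd).pow_const 2)
    · rw [Real.norm_of_nonneg (hF₁0 x)]; exact hpt₁ x
  have h1 : ∫ x, F₁ x ≤ ∫ x, G₁ x := integral_mono hF₁i hG₁i hpt₁
  have h2 : ∫ x, F₂ x ≤ ∫ x, Γ * K * m ^ 2 * mixedTerm H u ψ p α m 2 x :=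
    (le_abs_self _).trans
      (norm_integral_le_of_norm_le (hE2.const_mul _) (Filter.Eventually.of_forall hpt₂))
  have h3 : ∫ x, G₁ x = Γ * γ⁻¹ * (p - 1) * ((α + 1) / 2) ^ 2 * (∫ x, energyDensity H u ψ B α m x)
      + Γ * (p - 1) * M * (α + 1) * m * (∫ x, mixedTerm H u ψ p α m 1 x)
      + Γ * (p - 1) * M ^ 2 * m ^ 2 * (∫ x, mixedTerm H u ψ p α m 2 x) := by
    rw [← integral_const_mul, ← integral_const_mul, ← integral_const_mul,
      ← integral_add (hG.const_mul _) (hE1.const_mul _),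
      ← integral_add hG₁i' (hE2.const_mul _)]
  rw [integral_const_mul] at h2
  linarith

end Energy

section Liouville

variable {N : ℕ} {H u : EuclideanSpace ℝ (Fin N) → ℝ} {B : ℝ → ℝ} {p γ Γ q α : ℝ} {m : ℕ}

/-- Absorption: the equation and the stability inequality together control the potential term `X`
and the energy `Y` by the mixed terms `e₁`, `e₂`. -/
lemma absorb_mixed_terms {q α β P X Y e₁ e₂ : ℝ} (hα : 1 < α) (hβ : β < α * q) (hβ0 : 0 ≤ β)
    (hP : 0 ≤ P) (he₂ : 0 ≤ e₂) (hweak : |α * Y - X| ≤ P * e₁)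
    (hstab : q * X ≤ β * Y + P * e₁ + P * e₂) :
    (α * q - β) / 2 * (X + Y * α) ≤
      P * (α + β + (α * q - β) / 2) * (e₁ + e₂) := by
  have hweak' := (abs_le.1 hweak).2
  have hPe : 0 ≤ P * e₂ := mul_nonneg hP he₂
  have h1 := mul_le_mul_of_nonneg_left hstab (by linarith : 0 ≤ α)
  have h2 := mul_le_mul_of_nonneg_left hweak' hβ0
  have h3 := mul_le_mul_of_nonneg_left hweak' (by linarith : 0 ≤ (α * q - β) / 2)
  have h4 := mul_nonneg hβ0 hPe
  have h5 := mul_nonneg (by linarith : 0 ≤ (α * q - β) / 2) hPe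
  linarith

lemma mixedTerm_nonneg (hH : IsFinslerNorm H) {ψ : EuclideanSpace ℝ (Fin N) → ℝ}
    (hψ0 : ∀ x, 0 ≤ ψ x) (j : ℕ) (x : EuclideanSpace ℝ (Fin N)) :
    0 ≤ mixedTerm H u ψ p α m j x := by
  have h1 := hH.nonneg (gradient u x)
  have h2 := hψ0 x
  unfold mixedTerm
  positivity

lemma integrable_norm_gradient_rpow {ψ : EuclideanSpace ℝ (Fin N) → ℝ} (hψ : ContDiff ℝ 1 ψ)
    (hψc : HasCompactSupport ψ) {θ : ℝ} (hθ : 0 < θ) :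
    Integrable fun x => ‖gradient ψ x‖ ^ θ := by
  refine Continuous.integrable_of_hasCompactSupport
    ((continuous_gradient hψ).norm.rpow_const fun _ => Or.inr hθ.le) ?_
  refine (hψc.fderiv ℝ).mono fun x hx hx' => hx ?_
  simp [gradient, hx', Real.zero_rpow hθ.ne']

lemma integral_mixedTerm_le (hH : IsFinslerNorm H) (hHc : Continuous H) (hp : 1 < p)
    (hα : 1 < α) (hq : p - 1 < q) (hu : ContDiff ℝ 1 u)
    (hm : p * (q + α) / (q - (p - 1)) ≤ 2 * m) {ε : ℝ} (hε : 0 < ε) (j : ℕ)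
    (hj : 0 < j) (hjp : (j : ℝ) ≤ p) (hjm : j < 2 * m) :
    ∃ C : ℝ, 0 ≤ C ∧ ∀ ψ : EuclideanSpace ℝ (Fin N) → ℝ, ContDiff ℝ 1 ψ → HasCompactSupport ψ →
      (∀ x, 0 ≤ ψ x) → (∀ x, ψ x ≤ 1) →
      ∫ x, mixedTerm H u ψ p α m j x ≤
        ε * ((∫ x, |u x| ^ (α - 1) * H (gradient u x) ^ p * ψ x ^ (2 * m))
          + ∫ x, |u x| ^ (q + α) * ψ x ^ (2 * m))
        + C * ∫ x, ‖gradient ψ x‖ ^ (p * (q + α) / (q - (p - 1))) := by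
  obtain ⟨C, hC0, hC⟩ := mixed_term_young hp hα hq hε j (2 * m) hj hjp hjm.le (by push_cast; exact hm)
  refine ⟨C, hC0, fun ψ hψ hψc hψ0 hψ1 => ?_⟩
  have hm0 : 0 < m := by lia
  have hθ : 0 < p * (q + α) / (q - (p - 1)) :=
    div_pos (mul_pos (by linarith) (by linarith)) (by linarith)
  have i1 := integrable_power_density (m := m) hHc hu hψ hψc (by linarith : 0 < p) hα hm0
  have i2 := integrable_potential_density (m := m) (s := q + α) hu hψ hψc hm0 (by linarith)
  have i3 := integrable_norm_gradient_rpow hψ hψc hθ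
  have i12 : Integrable fun x => |u x| ^ (α - 1) * H (gradient u x) ^ p * ψ x ^ (2 * m)
      + |u x| ^ (q + α) * ψ x ^ (2 * m) := i1.add i2
  rw [← integral_add i1 i2, ← integral_const_mul, ← integral_const_mul,
    ← integral_add (i12.const_mul ε) (i3.const_mul C)]
  exact integral_mono (integrable_mixedTerm hHc hu hψ hψc hα hjp hjm)
    ((i12.const_mul ε).add (i3.const_mul C)) fun x =>
      hC _ _ _ _ (hH.nonneg _) (abs_nonneg _) (hψ0 x) (hψ1 x) (norm_nonneg _)

/-- The integral estimate for stable solutions. -/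
lemma stable_solution_integral_estimate (hH : IsFinslerNorm H) (hB : SatisfiesHB B p 0 γ Γ)
    (hp : 2 ≤ p) (hq : 1 < q) (hqp : p - 1 < q) (hu : ContDiff ℝ 1 u)
    (hsol : IsWeakSolutionOn Set.univ B H u q) (hstab : IsStableOn Set.univ Set.univ B H u q)
    (hα : 1 < α) (hαq : Γ * γ⁻¹ * (p - 1) * ((α + 1) / 2) ^ 2 < α * q) (hm : 2 ≤ m)
    (hmθ : p * (q + α) / (q - (p - 1)) ≤ 2 * m) :
    ∃ C : ℝ, ∀ ψ : EuclideanSpace ℝ (Fin N) → ℝ, ContDiff ℝ 1 ψ → HasCompactSupport ψ →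
      (∀ x, 0 ≤ ψ x) → (∀ x, ψ x ≤ 1) →
      ∫ x, |u x| ^ (q + α) * ψ x ^ (2 * m) ≤
        C * ∫ x, ‖gradient ψ x‖ ^ (p * (q + α) / (q - (p - 1))) := by
  have hγ : 0 < γ := hB.2.2.2.2.2.2.2.1
  have hΓ : 0 < Γ := hB.2.2.2.2.2.2.2.2.1
  have hp1 : 0 < p - 1 := by linarith
  obtain ⟨M, hM⟩ := hH.exists_lipschitzWith
  obtain ⟨K, hK0, hK⟩ := hH.exists_hessian_bound
  set β := Γ * γ⁻¹ * (p - 1) * ((α + 1) / 2) ^ 2 with hβ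
  have hβ0 : 0 ≤ β := by positivity
  set P₁ := Γ * M * (2 * m) with hP₁
  set P₂ := Γ * (p - 1) * M * (α + 1) * m with hP₂
  set P₃ := (Γ * (p - 1) * M ^ 2 + Γ * K) * m ^ 2 with hP₃
  have hα0 : 0 < α + 1 := by linarith
  have hP₁0 : 0 ≤ P₁ := by positivity
  have hP₂0 : 0 ≤ P₂ := by positivity
  have hP₃0 : 0 ≤ P₃ := by positivity
  set P := P₁ + P₂ + P₃ with hP
  have hP0 : 0 ≤ P := by positivity
  set δ := (α * q - β) / 2 with hδ
  have hδ0 : 0 < δ := by rw [hδ]; linarith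
  set Q := P * (α + β + δ) with hQ
  have hQ0 : 0 ≤ Q := mul_nonneg hP0 (by linarith)
  set ε := δ / (4 * (Q + 1) * (1 + γ⁻¹)) with hε
  have hε0 : 0 < ε := by positivity
  have hεδ : 2 * Q * ε * (1 + γ⁻¹) ≤ δ / 2 := by
    have : 2 * Q * ε * (1 + γ⁻¹) = δ / 2 * (Q / (Q + 1)) := by
      rw [hε]; field_simp; ring
    rw [this]
    refine mul_le_of_le_one_right (by linarith) ((div_le_one (by linarith)).2 (by linarith))
  obtain ⟨C₁, hC₁0, hC₁⟩ := integral_mixedTerm_le hH hM.continuous (by linarith) hα hqp hu hmθ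
    hε0 1 one_pos (by push_cast; linarith) (by lia)
  obtain ⟨C₂, hC₂0, hC₂⟩ := integral_mixedTerm_le hH hM.continuous (by linarith) hα hqp hu hmθ
    hε0 2 two_pos (by push_cast; linarith) (by lia)
  refine ⟨Q * (C₁ + C₂) / (δ / 2), fun ψ hψ hψc hψ0 hψ1 => ?_⟩
  have hm0 : 0 < m := by lia
  have hW := weak_solution_energy hH hB hM hp hq hu hsol hα hm0 hψ hψc hψ0
  have hS := stability_energy hH hB hM hK0 hK hp hq hu hstab hα hm hψ hψc hψ0
  have h1 := hC₁ ψ hψ hψc hψ0 hψ1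
  have h2 := hC₂ ψ hψ hψc hψ0 hψ1
  have he₁ : 0 ≤ ∫ x, mixedTerm H u ψ p α m 1 x := integral_nonneg (mixedTerm_nonneg hH hψ0 1)
  have he₂ : 0 ≤ ∫ x, mixedTerm H u ψ p α m 2 x := integral_nonneg (mixedTerm_nonneg hH hψ0 2)
  have hX : 0 ≤ ∫ x, |u x| ^ (q + α) * ψ x ^ (2 * m) := integral_nonneg fun x => by
    have := hψ0 x
    positivity
  have hY : 0 ≤ ∫ x, energyDensity H u ψ B α m x := integral_nonneg (energyDensity_nonneg hH hB)
  have hYW : (∫ x, |u x| ^ (α - 1) * H (gradient u x) ^ p * ψ x ^ (2 * m)) ≤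
      γ⁻¹ * ∫ x, energyDensity H u ψ B α m x := by
    rw [inv_mul_eq_div, le_div_iff₀ hγ, mul_comm, ← integral_const_mul]
    exact integral_mono
      ((integrable_power_density hM.continuous hu hψ hψc (by linarith) hα hm0).const_mul γ)
      (integrable_energyDensity hH hM.continuous hB hu hψ hψc hα hm0)
      (power_density_le_energyDensity hH hB)
  set X := ∫ x, |u x| ^ (q + α) * ψ x ^ (2 * m)
  set Y := ∫ x, energyDensity H u ψ B α m x
  set e₁ := ∫ x, mixedTerm H u ψ p α m 1 x
  set e₂ := ∫ x, mixedTerm H u ψ p α m 2 x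
  set T := ∫ x, ‖gradient ψ x‖ ^ (p * (q + α) / (q - (p - 1)))
  set W := ∫ x, |u x| ^ (α - 1) * H (gradient u x) ^ p * ψ x ^ (2 * m)
  have hA : δ * (X + Y * α) ≤ Q * (e₁ + e₂) := absorb_mixed_terms hα hαq hβ0 hP0 he₂
    (hW.trans (mul_le_mul_of_nonneg_right (by linarith) he₁))
    (hS.trans (add_le_add (add_le_add le_rfl (mul_le_mul_of_nonneg_right (by linarith) he₁))
      (mul_le_mul_of_nonneg_right (by linarith) he₂)))
  have hsum : e₁ + e₂ ≤ 2 * ε * (1 + γ⁻¹) * (X + Y) + (C₁ + C₂) * T := by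
    have hγ' : 0 ≤ γ⁻¹ := by positivity
    have i1 := mul_le_mul_of_nonneg_left hYW hε0.le
    have i2 : 0 ≤ ε * (γ⁻¹ * X) := by positivity
    have i3 : 0 ≤ ε * Y := by positivity
    linarith
  have h3 := mul_le_mul_of_nonneg_left hsum hQ0
  have h4 := mul_le_mul_of_nonneg_right hεδ (add_nonneg hX hY)
  have h5 : δ * (X + Y) ≤ δ * (X + Y * α) := by
    have : Y ≤ Y * α := le_mul_of_one_le_right hY hα.le
    gcongr
  have h6 : 0 ≤ δ / 2 * Y := by positivity
  rw [div_mul_eq_mul_div, le_div_iff₀ (by linarith)]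
  linarith

/-- Choice of the exponent in the test functions. -/
lemma exists_exponent {p q c n : ℝ} (hc : 0 < c) (hp : 0 < p) (hqp : p - 1 < q) (hcq : c < q)
    (hn : n < p * (c * (q - 1) + 2 * q + 2 * Real.sqrt (q * (q - c))) / (c * (q - (p - 1)))) :
    ∃ α : ℝ, 1 < α ∧ c * ((α + 1) / 2) ^ 2 < α * q ∧ n < p * (q + α) / (q - (p - 1)) := by
  set r := Real.sqrt (q * (q - c)) with hr
  have hq0 : 0 < q - (p - 1) := by linarith
  have hqc : 0 < q - c := by linarith
  have hr0 : 0 ≤ r := Real.sqrt_nonneg _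
  have hr2 : r ^ 2 = q * (q - c) := Real.sq_sqrt (by nlinarith)
  have hrc : q - c ≤ r := Real.le_sqrt_of_sq_le (by nlinarith)
  have hmax : max 1 (n * (q - (p - 1)) / p - q) < (2 * q - c + 2 * r) / c := by
    refine max_lt ((one_lt_div hc).2 (by linarith)) ?_
    rw [lt_div_iff₀ (by positivity)] at hn
    rw [sub_lt_iff_lt_add, div_lt_iff₀ hp, div_add' _ _ _ hc.ne', div_mul_eq_mul_div,
      lt_div_iff₀ hc]
    linarith
  obtain ⟨α, h1, h2⟩ := exists_between hmax
  obtain ⟨h1a, h1b⟩ := max_lt_iff.1 h1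
  refine ⟨α, h1a, ?_, ?_⟩
  · rw [lt_div_iff₀ hc] at h2
    have h3 : c < α * c := lt_mul_of_one_lt_left hc h1a
    have h4 : 0 < (2 * r - (α * c - (2 * q - c))) * (2 * r + (α * c - (2 * q - c))) :=
      mul_pos (by linarith) (by linarith)
    have h5 : 0 < c * (4 * (α * q) - c * (α + 1) ^ 2) := by linarith
    have := pos_of_mul_pos_right h5 hc.le
    linarith
  · rw [sub_lt_iff_lt_add, div_lt_iff₀ hp] at h1b
    rw [lt_div_iff₀ hq0]
    linarith

lemma integral_norm_gradient_comp_inv_smul {η : EuclideanSpace ℝ (Fin N) → ℝ} {R : ℝ}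
    (hR : 0 < R) (θ : ℝ) :
    ∫ x, ‖gradient (fun x => η (R⁻¹ • x)) x‖ ^ θ =
      R ^ ((N : ℝ) - θ) * ∫ x, ‖gradient η x‖ ^ θ := by
  have h1 : ∀ x, ‖gradient (fun x => η (R⁻¹ • x)) x‖ ^ θ =
      (R⁻¹) ^ θ * ‖gradient η (R⁻¹ • x)‖ ^ θ := fun x => by
    have : gradient (fun x => η (R⁻¹ • x)) x = R⁻¹ • gradient η (R⁻¹ • x) := by
      simp only [gradient]
      rw [fderiv_comp_smul, map_smul]
    rw [this, norm_smul, Real.norm_of_nonneg (by positivity),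
      Real.mul_rpow (by positivity) (norm_nonneg _)]
  simp_rw [h1]
  rw [integral_const_mul,
    Measure.integral_comp_inv_smul_of_nonneg volume (fun x => ‖gradient η x‖ ^ θ) hR.le,
    finrank_euclideanSpace_fin, smul_eq_mul, ← mul_assoc, Real.inv_rpow hR.le,
    ← Real.rpow_neg hR.le, ← Real.rpow_natCast, ← Real.rpow_add hR]
  congr 2; ring

/-- A scaling argument: a continuous nonnegative quantity whose weighted integrals are bounded by
supercritical powers of the gradient of the cut-off vanishes. -/
lemma eq_zero_of_cutoff_estimate {f : EuclideanSpace ℝ (Fin N) → ℝ} (hf : Continuous f)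
    (hf0 : ∀ x, 0 ≤ f x) {k : ℕ} (hk : k ≠ 0) {θ C : ℝ} (hθ : (N : ℝ) < θ)
    (h : ∀ ψ : EuclideanSpace ℝ (Fin N) → ℝ, ContDiff ℝ 1 ψ → HasCompactSupport ψ →
      (∀ x, 0 ≤ ψ x) → (∀ x, ψ x ≤ 1) →
      ∫ x, f x * ψ x ^ k ≤ C * ∫ x, ‖gradient ψ x‖ ^ θ)
    (x₀ : EuclideanSpace ℝ (Fin N)) : f x₀ = 0 := by
  by_contra hx₀
  let η : ContDiffBump (0 : EuclideanSpace ℝ (Fin N)) := ⟨1, 2, one_pos, one_lt_two⟩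
  have hη : ContDiff ℝ 1 η := η.contDiff
  set ψ : ℝ → EuclideanSpace ℝ (Fin N) → ℝ := fun R x => η (R⁻¹ • x) with hψ
  have hψd : ∀ R, ContDiff ℝ 1 (ψ R) := fun R => hη.comp (contDiff_const_smul R⁻¹)
  have hψc : ∀ R, 0 < R → HasCompactSupport (ψ R) := fun R hR =>
    η.hasCompactSupport.comp_smul (inv_ne_zero hR.ne')
  have hψone : ∀ R x, 0 < R → ‖x‖ ≤ R → ψ R x = 1 := fun R x hR hx => by
    refine η.one_of_mem_closedBall ?_
    rw [mem_closedBall_zero_iff, norm_smul, Real.norm_of_nonneg (by positivity),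
      inv_mul_le_iff₀ hR, mul_one]
    exact hx
  have hψzero : ∀ R x, 0 < R → 2 * R ≤ ‖x‖ → ψ R x = 0 := fun R x hR hx => by
    refine η.zero_of_le_dist ?_
    rw [dist_zero_right, norm_smul, Real.norm_of_nonneg (by positivity),
      le_inv_mul_iff₀ hR, mul_comm]
    exact hx
  have hint : ∀ R, 0 < R → Integrable fun x => f x * ψ R x ^ k := fun R hR =>
    (hf.mul ((hψd R).continuous.pow k)).integrable_of_hasCompactSupport
      (hasCompactSupport_of_zero (hψc R hR) fun x hx => by simp [hx, hk])
  set R₀ := ‖x₀‖ + 1 with hR₀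
  have hR₀0 : 0 < R₀ := by positivity
  have hpos : 0 < ∫ x, f x * ψ R₀ x ^ k := by
    refine Continuous.integral_pos_of_hasCompactSupport_nonneg_nonzero
      (hf.mul ((hψd R₀).continuous.pow k))
      (hasCompactSupport_of_zero (hψc R₀ hR₀0) fun x hx => by simp [hx, hk])
      (fun x => mul_nonneg (hf0 x) (pow_nonneg η.nonneg k)) (x := x₀) ?_
    rw [hψone R₀ x₀ hR₀0 (by linarith)]
    simpa using hx₀
  have hbound : ∀ R, 2 * R₀ ≤ R → ∫ x, f x * ψ R₀ x ^ k ≤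
      C * (R ^ ((N : ℝ) - θ) * ∫ x, ‖gradient η x‖ ^ θ) := fun R hR => by
    have hR0 : 0 < R := by linarith
    have h1 := h (ψ R) (hψd R) (hψc R hR0) (fun x => η.nonneg) (fun x => η.le_one)
    rw [integral_norm_gradient_comp_inv_smul hR0] at h1
    refine le_trans (integral_mono (hint R₀ hR₀0) (hint R hR0) fun x => ?_) h1
    rcases le_total ‖x‖ R with hx | hx
    · refine mul_le_mul_of_nonneg_left ?_ (hf0 x)
      rw [hψone R x hR0 hx, one_pow]
      exact pow_le_one₀ η.nonneg η.le_one
    · simp only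
      rw [hψzero R₀ x hR₀0 (hR.trans hx), zero_pow hk, mul_zero]
      exact mul_nonneg (hf0 x) (pow_nonneg η.nonneg k)
  have hlim : Filter.Tendsto
      (fun R : ℝ => C * (R ^ ((N : ℝ) - θ) * ∫ x, ‖gradient η x‖ ^ θ)) Filter.atTop (nhds 0) := by
    have := tendsto_rpow_neg_atTop (sub_pos.2 hθ)
    rw [neg_sub] at this
    simpa using (this.mul_const (∫ x, ‖gradient η x‖ ^ θ)).const_mul C
  exact absurd (ge_of_tendsto hlim (Filter.eventually_atTop.2 ⟨2 * R₀, hbound⟩)) (not_le.2 hpos)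

end Liouville

/-- Theorem 1.3(iii): Liouville theorem for stable solutions, case `κ = 0`. -/
theorem liouville_stable_case_iii {N : ℕ} (hN : 2 ≤ N)
    (H : EuclideanSpace ℝ (Fin N) → ℝ) (B : ℝ → ℝ)
    (u : EuclideanSpace ℝ (Fin N) → ℝ) (p γ Γ q : ℝ)
    (hH : IsFinslerNorm H) (hB : SatisfiesHB B p 0 γ Γ) (hp : 2 ≤ p) (hq : 1 < q)
    (hu : ContDiff ℝ 1 u)
    (hsol : IsWeakSolutionOn Set.univ B H u q)
    (hstab : IsStableOn Set.univ Set.univ B H u q)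
    (h2 : Γ * γ⁻¹ * (p - 1) < q)
    (hNs : (N : ℝ) < p * (Γ * γ⁻¹ * (p - 1) * (q - 1) + 2 * q +
        2 * Real.sqrt (q * (q - Γ * γ⁻¹ * (p - 1)))) /
        (Γ * γ⁻¹ * (p - 1) * (q - (p - 1)))) :
    ∀ x, u x = 0 := by
  have hp1 : 0 < p - 1 := by linarith
  have hratio := hB.one_le_ratio
  have hc : p - 1 ≤ Γ * γ⁻¹ * (p - 1) := le_mul_of_one_le_left hp1.le hratio
  have hqp : p - 1 < q := by linarith
  obtain ⟨α, hα, hαq, hNα⟩ := exists_exponent (by linarith) (by linarith) hqp h2 hNs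
  obtain ⟨m, hm⟩ := exists_nat_ge (p * (q + α) / (q - (p - 1)) + 2)
  have hm2 : 2 ≤ m := by
    have : 0 ≤ p * (q + α) / (q - (p - 1)) :=
      div_nonneg (mul_nonneg (by linarith) (by linarith)) (by linarith)
    have : (2 : ℝ) ≤ m := by linarith
    exact_mod_cast this
  obtain ⟨C, hC⟩ := stable_solution_integral_estimate hH hB hp hq hqp hu hsol hstab hα hαq hm2
    (by linarith [(Nat.cast_nonneg m : (0 : ℝ) ≤ m)])
  intro x
  have hx := eq_zero_of_cutoff_estimate (f := fun x => |u x| ^ (q + α))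
    (hu.continuous.abs.rpow_const fun _ => Or.inr (by linarith)) (fun x => by positivity)
    (by lia : 2 * m ≠ 0) hNα hC x
  have hqα : q + α ≠ 0 := by linarith
  exact abs_eq_zero.1 ((Real.rpow_eq_zero (abs_nonneg _) hqα).1 hx)
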